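/- arXiv:math/0310435 — 6 statements merged into one kernel-verified Lean document; each statement's English description precedes it below -/
import Mathlib

section
/- Let G1 be a finite connected simple graph with transition matrix M1 and root r1, and let G2 be a finite connected simple graph with transition matrix M2 and root r2. Call a real number λ a nondegenerate eigenvalue of (G,r) if there exists a nonzero vector v : V → ℝ with M.mulVec v = λ • v and v r ≠ 0. If (M1^k) r1 r1 = (M2^k) r2 r2 for every natural number k, then a real number λ is a nondegenerate eigenvalue of (G1,r1) if and only if it is a nondegenerate eigenvalue of (G2,r2). -/
open scoped Classical

/-- The transition matrix of the simple random walk on a finite simple graph: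
`M x y = 1 / deg x` if `x` and `y` are adjacent, and `0` otherwise. -/
noncomputable def transitionMatrix {V : Type*} [Fintype V] (G : SimpleGraph V) :
    Matrix V V ℝ :=
  fun x y => if G.Adj x y then (1 : ℝ) / (G.degree x : ℝ) else 0

open Polynomial in
/-- The `r`-th diagonal entry of `p(M)` depends only on the diagonal entries of the powers of `M`. -/
theorem aeval_apply_eq_of_pow_apply_eq {V W : Type*} [Fintype V] [Fintype W] [DecidableEq V]
    [DecidableEq W] {M : Matrix V V ℝ} {N : Matrix W W ℝ} {r : V} {s : W}
    (h : ∀ k : ℕ, (M ^ k) r r = (N ^ k) s s) (p : ℝ[X]) :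
    (aeval M p) r r = (aeval N p) s s := by
  simp [aeval_eq_sum_range, Matrix.sum_apply, h]

open Polynomial in
theorem aeval_mulVec_of_mulVec_eq_smul {V : Type*} [Fintype V] [DecidableEq V]
    {M : Matrix V V ℝ} {v : V → ℝ} {μ : ℝ} (h : M.mulVec v = μ • v) (p : ℝ[X]) :
    (aeval M p).mulVec v = p.eval μ • v := by
  induction p using Polynomial.induction_on with
  | C a => simp [Algebra.algebraMap_eq_smul_one, Matrix.smul_mulVec]
  | add p q hp hq => simp [Matrix.add_mulVec, hp, hq, add_smul]
  | monomial n a ih =>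
    rw [pow_succ, ← mul_assoc, map_mul, aeval_X, ← Matrix.mulVec_mulVec, h, Matrix.mulVec_smul,
      ih, eval_mul_X, smul_smul, mul_comm]

open Polynomial in
/-- Detailed balance for `M` passes to polynomials in `M`. -/
theorem aeval_detailed_balance {V : Type*} [Fintype V] [DecidableEq V]
    {M : Matrix V V ℝ} {w : V → ℝ} (h : ∀ x y, w x * M x y = w y * M y x) (p : ℝ[X]) (x y : V) :
    w x * (aeval M p) x y = w y * (aeval M p) y x := by
  induction p using Polynomial.induction_on generalizing x y with
  | C a =>
    by_cases hxy : x = y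
    · rw [hxy]
    · simp [Matrix.algebraMap_matrix_apply, hxy, Ne.symm hxy]
  | add p q hp hq => simp [mul_add, hp x y, hq x y]
  | monomial n a ih =>
    have hleft : aeval M (C a * X ^ (n + 1)) = aeval M (C a * X ^ n) * M := by
      simp [pow_succ, mul_assoc]
    have hright : aeval M (C a * X ^ (n + 1)) = M * aeval M (C a * X ^ n) := by
      rw [pow_succ', mul_left_comm, map_mul, aeval_X]
    nth_rewrite 1 [hleft]
    rw [hright, Matrix.mul_apply, Matrix.mul_apply, Finset.mul_sum, Finset.mul_sum]
    refine Finset.sum_congr rfl fun z _ => ?_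
    rw [← mul_assoc, ih x z, ← mul_assoc, h y z]
    ring

open Polynomial in
/-- For a reversible matrix, the `r`-th column of `p(M)` vanishes iff the diagonal entry of
`p(M) ^ 2` at `r` does. -/
theorem aeval_sq_apply_eq_zero_iff {V : Type*} [Fintype V] [DecidableEq V]
    {M : Matrix V V ℝ} {w : V → ℝ} (hw : ∀ x, 0 < w x)
    (h : ∀ x y, w x * M x y = w y * M y x) (p : ℝ[X]) (r : V) :
    (aeval M (p ^ 2)) r r = 0 ↔ ∀ x, (aeval M p) x r = 0 := by
  have hsum : w r * (aeval M (p ^ 2)) r r = ∑ x, w x * (aeval M p) x r ^ 2 := by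
    rw [pow_two, map_mul, Matrix.mul_apply, Finset.mul_sum]
    refine Finset.sum_congr rfl fun x _ => ?_
    linear_combination (aeval M p) x r * aeval_detailed_balance h p r x
  have hnonneg : ∀ x ∈ Finset.univ, 0 ≤ w x * (aeval M p) x r ^ 2 := fun x _ =>
    mul_nonneg (hw x).le (sq_nonneg _)
  rw [← mul_eq_zero_iff_left (hw r).ne', hsum, Finset.sum_eq_zero_iff_of_nonneg hnonneg]
  simp [(hw _).ne']

open Polynomial in
/-- For a reversible matrix, a column annihilated by a power of `M - μ` is annihilated by
`M - μ`. -/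
theorem aeval_column_eq_zero_of_pow {V : Type*} [Fintype V] [DecidableEq V]
    {M : Matrix V V ℝ} {w : V → ℝ} (hw : ∀ x, 0 < w x)
    (h : ∀ x y, w x * M x y = w y * M y x) {r : V} {μ : ℝ} {q : ℝ[X]} (n : ℕ)
    (hn : ∀ x, (aeval M ((X - C μ) ^ (n + 1) * q)) x r = 0) :
    ∀ x, (aeval M ((X - C μ) * q)) x r = 0 := by
  induction n with
  | zero => simpa using hn
  | succ n ih =>
    refine ih ((aeval_sq_apply_eq_zero_iff hw h _ r).1 ?_)
    have hfactor : ((X - C μ) ^ (n + 1) * q) ^ 2 =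
        ((X - C μ) ^ n * q) * ((X - C μ) ^ (n + 1 + 1) * q) := by ring
    rw [hfactor, map_mul, Matrix.mul_apply]
    exact Finset.sum_eq_zero fun x _ => by rw [hn x, mul_zero]

open Polynomial in
/-- Nondegenerate eigenvalues of a reversible matrix, in terms of the diagonal entries at `r` of
polynomials in the matrix. -/
theorem exists_eigenvector_apply_ne_zero_iff {V : Type*} [Fintype V] [DecidableEq V]
    {M : Matrix V V ℝ} {w : V → ℝ} (hw : ∀ x, 0 < w x)
    (h : ∀ x y, w x * M x y = w y * M y x) (r : V) (μ : ℝ) :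
    (∃ v : V → ℝ, v ≠ 0 ∧ M.mulVec v = μ • v ∧ v r ≠ 0) ↔
      ∃ q : ℝ[X], (aeval M (q ^ 2)) r r ≠ 0 ∧ (aeval M (((X - C μ) * q) ^ 2)) r r = 0 := by
  constructor
  · rintro ⟨v, -, hv, hvr⟩
    obtain ⟨q, hq, hdvd⟩ :=
      exists_eq_pow_rootMultiplicity_mul_and_not_dvd M.charpoly M.charpoly_monic.ne_zero μ
    rw [dvd_iff_isRoot, IsRoot.def] at hdvd
    refine ⟨q, fun hzero => ?_, ?_⟩
    · rw [aeval_sq_apply_eq_zero_iff hw h] at hzero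
      have hrow : ∀ x, (aeval M q) r x = 0 := fun x => by
        have hbal := aeval_detailed_balance h q r x
        rw [hzero x, mul_zero] at hbal
        exact (mul_eq_zero.1 hbal).resolve_left (hw r).ne'
      have heig := congrFun (aeval_mulVec_of_mulVec_eq_smul hv q) r
      simp [Matrix.mulVec, dotProduct, hrow, hdvd, hvr] at heig
    · rw [aeval_sq_apply_eq_zero_iff hw h]
      refine aeval_column_eq_zero_of_pow hw h (M.charpoly.rootMultiplicity μ) fun x => ?_
      rw [pow_succ', mul_assoc, ← hq, map_mul, Matrix.aeval_self_charpoly, mul_zero,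
        Matrix.zero_apply]
  · rintro ⟨q, hq, hzero⟩
    rw [aeval_sq_apply_eq_zero_iff hw h] at hzero
    have hv : M.mulVec (fun x => (aeval M q) x r) = μ • fun x => (aeval M q) x r := by
      ext x
      have hx := hzero x
      rw [map_mul, map_sub, aeval_X, aeval_C, sub_mul, Matrix.sub_apply, sub_eq_zero,
        Algebra.algebraMap_eq_smul_one, smul_mul_assoc, one_mul] at hx
      exact hx
    have hvr : (aeval M q) r r ≠ 0 := fun hr => hq <| by
      have heig := congrFun (aeval_mulVec_of_mulVec_eq_smul hv q) r
      rw [Pi.smul_apply, hr, smul_zero] at heig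
      rw [pow_two, map_mul]
      exact heig
    exact ⟨fun x => (aeval M q) x r, fun hv0 => hvr (congrFun hv0 r), hv, hvr⟩

/-- The simple random walk on a finite graph is reversible. -/
theorem exists_transitionMatrix_detailed_balance {V : Type*} [Fintype V] (G : SimpleGraph V) :
    ∃ w : V → ℝ, (∀ x, 0 < w x) ∧
      ∀ x y, w x * transitionMatrix G x y = w y * transitionMatrix G y x := by
  refine ⟨fun x => if G.degree x = 0 then 1 else G.degree x, fun x => ?_, fun x y => ?_⟩
  · dsimp only
    split_ifs with hx
    · exact one_pos
    · exact_mod_cast Nat.pos_of_ne_zero hx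
  · by_cases hxy : G.Adj x y
    · have hx : G.degree x ≠ 0 := (G.degree_pos_iff_exists_adj x |>.2 ⟨y, hxy⟩).ne'
      have hy : G.degree y ≠ 0 := (G.degree_pos_iff_exists_adj y |>.2 ⟨x, hxy.symm⟩).ne'
      simp [transitionMatrix, hxy, hxy.symm, hx, hy]
    · simp [transitionMatrix, hxy, G.adj_comm y x]


/-- If two rooted finite connected graphs have the same return-probability sequence,
then they have the same nondegenerate eigenvalues. -/
theorem stmt_0 {V1 V2 : Type*} [Fintype V1] [Fintype V2]
    (G1 : SimpleGraph V1) (G2 : SimpleGraph V2)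
    (hc1 : G1.Connected) (hc2 : G2.Connected) (r1 : V1) (r2 : V2)
    (hret : ∀ k : ℕ,
      ((transitionMatrix G1) ^ k) r1 r1 = ((transitionMatrix G2) ^ k) r2 r2)
    (lam : ℝ) :
    (∃ v : V1 → ℝ, v ≠ 0 ∧ (transitionMatrix G1).mulVec v = lam • v ∧ v r1 ≠ 0) ↔
    (∃ w : V2 → ℝ, w ≠ 0 ∧ (transitionMatrix G2).mulVec w = lam • w ∧ w r2 ≠ 0) := by
  obtain ⟨w₁, hw₁, hbal₁⟩ := exists_transitionMatrix_detailed_balance G1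
  obtain ⟨w₂, hw₂, hbal₂⟩ := exists_transitionMatrix_detailed_balance G2
  simp only [exists_eigenvector_apply_ne_zero_iff hw₁ hbal₁,
    exists_eigenvector_apply_ne_zero_iff hw₂ hbal₂, aeval_apply_eq_of_pow_apply_eq hret]
end

section
/- Let G be a finite connected d-regular simple graph on n ≥ 4 vertices with adjacency matrix A, and let M' = (1/2)·(I + (1/d)·A) be the lazy transition matrix. Then for every natural number k, trace(M'^{k+1}) − 1 ≥ (1/3)·(trace(M'^k) − 1). -/
open scoped Classical

/-- The trace of a power of a Hermitian matrix is the corresponding power sum of eigenvalues. -/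
theorem Matrix.IsHermitian.trace_pow_eq_sum_eigenvalues_pow {n : Type*} [Fintype n]
    [DecidableEq n] {A : Matrix n n ℝ} (hA : A.IsHermitian) (k : ℕ) :
    (A ^ k).trace = ∑ i, hA.eigenvalues i ^ k := by
  conv_lhs => rw [hA.spectral_theorem, ← map_pow, Unitary.conjStarAlgAut_apply,
    Matrix.trace_mul_cycle, Unitary.coe_star_mul_self, one_mul, Matrix.diagonal_pow,
    Matrix.trace_diagonal]
  simp

/-- A real eigenvalue of a lazy stochastic matrix is nonnegative. -/
theorem Matrix.nonneg_of_mem_spectrum_of_lazy {n : Type*} [Fintype n] [DecidableEq n]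
    {A : Matrix n n ℝ} (hnonneg : ∀ i j, 0 ≤ A i j) (hsum : ∀ i, ∑ j, A i j = 1)
    (hdiag : ∀ i, 1 / 2 ≤ A i i) {μ : ℝ} (hμ : μ ∈ spectrum ℝ A) : 0 ≤ μ := by
  rw [← Matrix.spectrum_toLin', ← Module.End.hasEigenvalue_iff_mem_spectrum] at hμ
  obtain ⟨i, hi⟩ := eigenvalue_mem_ball hμ
  have hnorm : ∑ j ∈ Finset.univ.erase i, ‖A i j‖ = ∑ j ∈ Finset.univ.erase i, A i j :=
    Finset.sum_congr rfl fun j _ => Real.norm_of_nonneg (hnonneg i j)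
  have hsplit := Finset.add_sum_erase Finset.univ (A i) (Finset.mem_univ i)
  rw [Metric.mem_closedBall, Real.dist_eq, hnorm] at hi
  linarith [(abs_le.mp hi).1, hsum i, hdiag i]

/-- One is an eigenvalue of a matrix with unit row sums. -/
theorem Matrix.one_mem_spectrum_of_row_sum_eq_one {n : Type*} [Fintype n] [DecidableEq n]
    [Nonempty n] {A : Matrix n n ℝ} (hsum : ∀ i, ∑ j, A i j = 1) : (1 : ℝ) ∈ spectrum ℝ A := by
  rw [← Matrix.spectrum_toLin', ← Module.End.hasEigenvalue_iff_mem_spectrum]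
  refine Module.End.hasEigenvalue_of_hasEigenvector (x := 1)
    ⟨Module.End.mem_eigenspace_iff.mpr ?_, one_ne_zero⟩
  ext i
  simp [Matrix.mulVec, dotProduct, hsum]

theorem pow_mul_sub_le_pow_mul_sub {x c : ℝ} (hx : 0 ≤ x) (hc : 0 ≤ c) (k : ℕ) :
    c ^ k * (x - c) ≤ x ^ k * (x - c) := by
  rcases le_total c x with h | h
  · exact mul_le_mul_of_nonneg_right (pow_le_pow_left₀ hc h k) (sub_nonneg.mpr h)
  · exact mul_le_mul_of_nonpos_right (pow_le_pow_left₀ hx h k) (sub_nonpos.mpr h)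

/-- Consecutive power traces of a symmetric lazy stochastic matrix with trace `n / 2`, `n ≥ 4`,
with the trivial eigenvalue removed. -/
theorem Matrix.IsHermitian.trace_pow_succ_sub_one_ge {n : Type*} [Fintype n] [DecidableEq n]
    {A : Matrix n n ℝ} (hA : A.IsHermitian) (hcard : 4 ≤ Fintype.card n)
    (hnonneg : ∀ i j, 0 ≤ A i j) (hsum : ∀ i, ∑ j, A i j = 1) (hdiag : ∀ i, A i i = 1 / 2)
    (k : ℕ) : (1 / 3 : ℝ) * ((A ^ k).trace - 1) ≤ (A ^ (k + 1)).trace - 1 := by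
  have : Nonempty n := Fintype.card_pos_iff.mp (by omega)
  have hpos (i : n) : 0 ≤ hA.eigenvalues i :=
    Matrix.nonneg_of_mem_spectrum_of_lazy hnonneg hsum (fun i => (hdiag i).ge)
      (hA.eigenvalues_mem_spectrum_real i)
  obtain ⟨i₀, hi₀⟩ : (1 : ℝ) ∈ Set.range hA.eigenvalues :=
    hA.spectrum_real_eq_range_eigenvalues ▸ Matrix.one_mem_spectrum_of_row_sum_eq_one hsum
  have htrace : ∑ i, hA.eigenvalues i = Fintype.card n / 2 := by
    have h := hA.trace_eq_sum_eigenvalues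
    simp only [Matrix.trace, Matrix.diag, hdiag, RCLike.ofReal_real_eq_id, id] at h
    rw [← h]
    simp [div_eq_mul_inv]
  have hterm (i : n) : 0 ≤ hA.eigenvalues i ^ k * (hA.eigenvalues i - 1 / 3) -
      (1 / 3) ^ k * (hA.eigenvalues i - 1 / 3) :=
    sub_nonneg.mpr (pow_mul_sub_le_pow_mul_sub (hpos i) (by norm_num) k)
  have hle := Finset.single_le_sum (fun i _ => hterm i) (Finset.mem_univ i₀)
  have hexpand : ∑ i, (hA.eigenvalues i ^ k * (hA.eigenvalues i - 1 / 3) -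
      (1 / 3) ^ k * (hA.eigenvalues i - 1 / 3)) = (A ^ (k + 1)).trace - 1 / 3 * (A ^ k).trace -
      (1 / 3) ^ k * ((Fintype.card n : ℝ) / 6) := by
    rw [hA.trace_pow_eq_sum_eigenvalues_pow, hA.trace_pow_eq_sum_eigenvalues_pow,
      Finset.sum_sub_distrib, ← Finset.mul_sum, Finset.sum_sub_distrib, htrace, Finset.mul_sum,
      ← Finset.sum_sub_distrib, Finset.sum_const, Finset.card_univ, nsmul_eq_mul]
    congr 1
    · exact Finset.sum_congr rfl fun i _ => by ring
    · ring
  rw [hexpand, hi₀, one_pow] at hle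
  have hcard' : (4 : ℝ) ≤ Fintype.card n := by exact_mod_cast hcard
  have hc : (0 : ℝ) ≤ (1 / 3) ^ k := by positivity
  nlinarith [mul_nonneg hc (sub_nonneg.mpr hcard')]

/-- For the lazy walk on a connected `d`-regular graph on `n ≥ 4` vertices,
`trace (M'^(k+1)) - 1 ≥ (1/3) (trace (M'^k) - 1)`. -/
theorem stmt_9 {V : Type*} [Fintype V] [DecidableEq V] (G : SimpleGraph V)
    (hc : G.Connected) (hcard : 4 ≤ Fintype.card V)
    (d : ℕ) (hreg : G.IsRegularOfDegree d)
    (M' : Matrix V V ℝ)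
    (hM' : M' = (1 / 2 : ℝ) • ((1 : Matrix V V ℝ) + (1 / (d : ℝ)) • G.adjMatrix ℝ))
    (k : ℕ) :
    Matrix.trace (M' ^ (k + 1)) - 1 ≥ (1 / 3 : ℝ) * (Matrix.trace (M' ^ k) - 1) := by
  have : Nontrivial V := Fintype.one_lt_card_iff_nontrivial.mp (by omega)
  obtain ⟨v⟩ := hc.nonempty
  have hd : (d : ℝ) ≠ 0 := by
    have h := hc.preconnected.degree_pos_of_nontrivial v
    rw [hreg v] at h
    exact_mod_cast h.ne'
  have hrow (i : V) : ∑ j, G.adjMatrix ℝ i j = d := by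
    have h := SimpleGraph.adjMatrix_mulVec_const_apply_of_regular (α := ℝ) (a := 1) hreg (v := i)
    simpa only [Matrix.mulVec, dotProduct, Function.const_apply, mul_one] using h
  subst hM'
  refine Matrix.IsHermitian.trace_pow_succ_sub_one_ge ?_ hcard (fun i j => ?_) (fun i => ?_)
    (fun i => ?_) k
  · rw [Matrix.IsHermitian, Matrix.conjTranspose_eq_transpose_of_trivial]
    simp
  · simp only [Matrix.smul_apply, Matrix.add_apply, Matrix.one_apply, SimpleGraph.adjMatrix_apply,
      smul_eq_mul]
    positivity
  · simp only [Matrix.smul_apply, Matrix.add_apply, smul_eq_mul, ← Finset.mul_sum,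
      Finset.sum_add_distrib, hrow, Matrix.one_apply, Finset.sum_ite_eq, Finset.mem_univ, if_true]
    field_simp
    norm_num
  · simp
end

section
/- Let G be a finite connected vertex-transitive simple graph on n ≥ 4 vertices, d-regular with adjacency matrix A, let M' = (1/2)·(I + (1/d)·A) be the lazy transition matrix, let λ_2 be the second largest eigenvalue of M' (the largest eigenvalue on the orthogonal complement of the constant vectors), and fix a vertex r and an integer k ≥ 1. Set q_k = (M'^k) r r − 1/n. Then λ_2^k / n ≤ q_k ≤ λ_2^k; in particular 0 < q_k < 1. -/
open scoped Classical

namespace LazyWalk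

open Matrix

variable {V : Type*} [Fintype V]

/-- The orthogonal projection onto the constant vectors. -/
noncomputable def constProj (V : Type*) [Fintype V] : Matrix V V ℝ :=
  Matrix.of fun _ _ => 1 / (Fintype.card V : ℝ)

theorem constProj_mulVec (v : V → ℝ) :
    constProj V *ᵥ v = fun _ => 1 / (Fintype.card V : ℝ) * ∑ x, v x := by
  ext x
  simp [constProj, mulVec, dotProduct, Finset.mul_sum]

theorem constProj_mul_self [Nonempty V] : constProj V * constProj V = constProj V := by
  ext x y
  simp [constProj, mul_apply]

variable [DecidableEq V]

theorem trace_pow_eq_sum_eigenvalues_pow {A : Matrix V V ℝ} (hA : A.IsHermitian) (k : ℕ) :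
    (A ^ k).trace = ∑ i, hA.eigenvalues i ^ k := by
  conv_lhs => rw [hA.spectral_theorem, ← map_pow, Unitary.conjStarAlgAut_apply,
    trace_mul_cycle, Unitary.coe_star_mul_self, one_mul, diagonal_pow, trace_diagonal]
  simp

theorem exists_eigenvector_eigenvalues {A : Matrix V V ℝ} (hA : A.IsHermitian) (i : V) :
    ∃ v : V → ℝ, v ≠ 0 ∧ A *ᵥ v = hA.eigenvalues i • v :=
  ⟨hA.eigenvectorBasis i, fun h => hA.eigenvectorBasis.orthonormal.ne_zero i
    (by ext x; exact congrFun h x),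
    hA.mulVec_eigenvectorBasis i⟩

theorem exists_eigenvalues_eq {A : Matrix V V ℝ} (hA : A.IsHermitian) {mu : ℝ} {v : V → ℝ}
    (hv : v ≠ 0) (h : A *ᵥ v = mu • v) : ∃ i, hA.eigenvalues i = mu := by
  have hmem : mu ∈ spectrum ℝ A := by
    rw [← Matrix.spectrum_toLin']
    exact (Module.End.hasEigenvalue_of_hasEigenvector
      ⟨Module.End.mem_eigenspace_iff.2 (by simpa using h), hv⟩).mem_spectrum
  rwa [hA.spectrum_real_eq_range_eigenvalues] at hmem

theorem mul_constProj {M : Matrix V V ℝ} (hM : M ∈ rowStochastic ℝ V) :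
    M * constProj V = constProj V := by
  ext x y
  simp [constProj, mul_apply, ← Finset.sum_mul, sum_row_of_mem_rowStochastic hM]

theorem constProj_mul {M : Matrix V V ℝ} (hM : M ∈ rowStochastic ℝ V) (hs : M.IsHermitian) :
    constProj V * M = constProj V := by
  have h := congrArg transpose (mul_constProj hM)
  have hs' : Mᵀ = M := by simpa [IsHermitian] using hs
  have hP : (constProj V)ᵀ = constProj V := rfl
  rwa [transpose_mul, hs', hP] at h

theorem sub_constProj_pow [Nonempty V] {M : Matrix V V ℝ} (hM : M ∈ rowStochastic ℝ V)
    (hs : M.IsHermitian) {k : ℕ} (hk : 1 ≤ k) :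
    (M - constProj V) ^ k = M ^ k - constProj V := by
  induction k, hk using Nat.le_induction with
  | base => simp
  | succ k _ ih =>
    rw [pow_succ, ih, sub_mul, mul_sub, mul_sub, constProj_mul hM hs, constProj_mul_self,
      mul_constProj (pow_mem hM k), ← pow_succ]
    abel

/-- Eigenvectors of `M - constProj V` for a nonzero eigenvalue are eigenvectors of `M`
orthogonal to the constants. -/
theorem eigenvector_of_sub_constProj [Nonempty V] {M : Matrix V V ℝ}
    (hM : M ∈ rowStochastic ℝ V) (hs : M.IsHermitian) {mu : ℝ} (hmu : mu ≠ 0) {v : V → ℝ}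
    (h : (M - constProj V) *ᵥ v = mu • v) : ∑ x, v x = 0 ∧ M *ᵥ v = mu • v := by
  have h0 : constProj V *ᵥ v = 0 := by
    have := congrArg (constProj V *ᵥ ·) h
    simp only [mulVec_mulVec, mul_sub, constProj_mul hM hs, constProj_mul_self, sub_self,
      zero_mulVec, mulVec_smul] at this
    exact (smul_eq_zero.1 this.symm).resolve_left hmu
  refine ⟨?_, by rwa [sub_mulVec, h0, sub_zero] at h⟩
  rw [constProj_mulVec] at h0
  simpa using congrFun h0 (Classical.arbitrary V)

theorem pow_apply_self_eq {M : Matrix V V ℝ} (e : V ≃ V)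
    (he : ∀ x y, M (e x) (e y) = M x y) (k : ℕ) (x : V) :
    (M ^ k) (e x) (e x) = (M ^ k) x x := by
  have h : reindexAlgEquiv ℝ ℝ e.symm M = M := by
    ext x y
    simpa using he x y
  have hp := map_pow (reindexAlgEquiv ℝ ℝ e.symm) M k
  rw [h] at hp
  simpa using congrFun (congrFun hp x) x

theorem eigenvalue_nonneg_of_half_diag {M : Matrix V V ℝ} (hM : M ∈ rowStochastic ℝ V)
    (hd : ∀ x, M x x = 1 / 2) {mu : ℝ} {v : V → ℝ} (hv : v ≠ 0) (h : M *ᵥ v = mu • v) :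
    0 ≤ mu := by
  obtain ⟨x, hx⟩ := eigenvalue_mem_ball (A := M) (Module.End.hasEigenvalue_of_hasEigenvector
    ⟨Module.End.mem_eigenspace_iff.2 (by simpa using h), hv⟩)
  have hsum : ∑ j ∈ Finset.univ.erase x, ‖M x j‖ = 1 / 2 := by
    have h1 := Finset.add_sum_erase Finset.univ (M x) (Finset.mem_univ x)
    rw [sum_row_of_mem_rowStochastic hM, hd] at h1
    rw [Finset.sum_congr rfl fun j _ =>
      Real.norm_of_nonneg (nonneg_of_mem_rowStochastic hM)]
    linarith
  rw [hsum, hd, Metric.mem_closedBall, Real.dist_eq] at hx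
  linarith [(abs_le.1 hx).1]

theorem lazy_mem_rowStochastic (G : SimpleGraph V) {d : ℕ} (hd : d ≠ 0)
    (hreg : G.IsRegularOfDegree d) :
    (1 / 2 : ℝ) • ((1 : Matrix V V ℝ) + (1 / (d : ℝ)) • G.adjMatrix ℝ) ∈ rowStochastic ℝ V := by
  rw [mem_rowStochastic]
  refine ⟨fun x y => ?_, ?_⟩
  · change 0 ≤ ((1 / 2 : ℝ) • ((1 : Matrix V V ℝ) + (1 / (d : ℝ)) • G.adjMatrix ℝ)) x y
    simp only [Matrix.smul_apply, Matrix.add_apply, smul_eq_mul, one_apply, SimpleGraph.adjMatrix_apply]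
    positivity
  · ext x
    have h : (G.adjMatrix ℝ *ᵥ 1) x = d := by
      rw [← hreg x]
      simp [SimpleGraph.adjMatrix_mulVec_apply]
    have hd' : (d : ℝ) ≠ 0 := by exact_mod_cast hd
    simp only [smul_mulVec, add_mulVec, one_mulVec, Pi.smul_apply, Pi.add_apply, h, Pi.one_apply,
      smul_eq_mul]
    field_simp
    norm_num

theorem lazy_isHermitian {W : Type*} [DecidableEq W] (G : SimpleGraph W) (d : ℕ) :
    ((1 / 2 : ℝ) • ((1 : Matrix W W ℝ) + (1 / (d : ℝ)) • G.adjMatrix ℝ)).IsHermitian := by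
  simp [IsHermitian]

/-- Bounds on the return probabilities of a symmetric lazy chain in terms of the trace. -/
theorem trace_sub_constProj_pow_bounds {M : Matrix V V ℝ} (hM : M ∈ rowStochastic ℝ V)
    (hs : M.IsHermitian) (hd : ∀ x, M x x = 1 / 2) (hcard : 3 ≤ Fintype.card V) {lam2 : ℝ}
    (hev : ∃ v : V → ℝ, v ≠ 0 ∧ (∑ x, v x) = 0 ∧ M *ᵥ v = lam2 • v)
    (hmax : ∀ (mu : ℝ) (v : V → ℝ), v ≠ 0 → (∑ x, v x) = 0 → M *ᵥ v = mu • v → mu ≤ lam2)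
    (k : ℕ) :
    0 < lam2 ∧ lam2 ^ k ≤ ((M - constProj V) ^ k).trace ∧
      ((M - constProj V) ^ k).trace ≤ Fintype.card V * lam2 ^ k := by
  have : Nonempty V := Fintype.card_pos_iff.1 (by omega)
  have hN : (M - constProj V).IsHermitian := hs.sub (by ext; simp [constProj])
  obtain ⟨w, hw0, hwsum, hw⟩ := hev
  have hlam0 : 0 ≤ lam2 := eigenvalue_nonneg_of_half_diag hM hd hw0 hw
  have hbound (i : V) : 0 ≤ hN.eigenvalues i ∧ hN.eigenvalues i ≤ lam2 := by
    obtain ⟨v, hv0, hv⟩ := exists_eigenvector_eigenvalues hN i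
    by_cases hmu : hN.eigenvalues i = 0
    · exact ⟨hmu.ge, hmu.le.trans hlam0⟩
    · obtain ⟨hsum, hMv⟩ := eigenvector_of_sub_constProj hM hs hmu hv
      exact ⟨eigenvalue_nonneg_of_half_diag hM hd hv0 hMv, hmax _ v hv0 hsum hMv⟩
  have hupper (j : ℕ) : ((M - constProj V) ^ j).trace ≤ Fintype.card V * lam2 ^ j := by
    rw [trace_pow_eq_sum_eigenvalues_pow hN, ← nsmul_eq_mul]
    exact Finset.sum_le_card_nsmul _ _ _ fun i _ =>
      pow_le_pow_left₀ (hbound i).1 (hbound i).2 j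
  refine ⟨hlam0.lt_of_ne' fun h0 => ?_, ?_, hupper k⟩
  · have h1 := hupper 1
    have hc : (3 : ℝ) ≤ Fintype.card V := by exact_mod_cast hcard
    have hc0 : (Fintype.card V : ℝ) ≠ 0 := by positivity
    have htr : (M - constProj V).trace = Fintype.card V / 2 - 1 := by
      simp [trace, hd, constProj, hc0, div_eq_mul_inv]
    rw [h0, pow_one, pow_one, htr] at h1
    linarith
  · obtain ⟨i, hi⟩ := exists_eigenvalues_eq hN hw0 (mu := lam2) <| by
      rw [sub_mulVec, hw, constProj_mulVec, hwsum]
      ext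
      simp
    rw [trace_pow_eq_sum_eigenvalues_pow hN, ← hi]
    exact Finset.single_le_sum (f := fun i => hN.eigenvalues i ^ k)
      (fun j _ => pow_nonneg (hbound j).1 k) (Finset.mem_univ i)

end LazyWalk

/-- For the lazy walk on a connected vertex-transitive `d`-regular graph on `n ≥ 4`
vertices, with `lam2` the second largest eigenvalue and `q_k = (M'^k) r r - 1/n`:
`lam2^k / n ≤ q_k ≤ lam2^k` and `0 < q_k < 1`. -/
theorem stmt_10 {V : Type*} [Fintype V] [DecidableEq V] (G : SimpleGraph V)
    (hc : G.Connected)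
    (hvt : ∀ u v : V, ∃ φ : G ≃g G, φ u = v)
    (hcard : 4 ≤ Fintype.card V)
    (d : ℕ) (hreg : G.IsRegularOfDegree d)
    (M' : Matrix V V ℝ)
    (hM' : M' = (1 / 2 : ℝ) • ((1 : Matrix V V ℝ) + (1 / (d : ℝ)) • G.adjMatrix ℝ))
    (lam2 : ℝ)
    (hlam2ev : ∃ v : V → ℝ, v ≠ 0 ∧ (∑ x, v x) = 0 ∧ M'.mulVec v = lam2 • v)
    (hlam2max : ∀ (mu : ℝ) (v : V → ℝ), v ≠ 0 → (∑ x, v x) = 0 →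
      M'.mulVec v = mu • v → mu ≤ lam2)
    (r : V) (k : ℕ) (hk : 1 ≤ k)
    (qk : ℝ) (hqk : qk = (M' ^ k) r r - 1 / (Fintype.card V : ℝ)) :
    lam2 ^ k / (Fintype.card V : ℝ) ≤ qk ∧ qk ≤ lam2 ^ k ∧ 0 < qk ∧ qk < 1 := by
  have : Nontrivial V := Fintype.one_lt_card_iff_nontrivial.1 (by omega)
  have hn : (0 : ℝ) < Fintype.card V := by positivity
  have hd0 : d ≠ 0 := by
    rintro rfl
    exact (hc.preconnected.degree_pos_of_nontrivial r).ne' (hreg r)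
  have hM : M' ∈ Matrix.rowStochastic ℝ V := hM' ▸ LazyWalk.lazy_mem_rowStochastic G hd0 hreg
  have hs : M'.IsHermitian := hM' ▸ LazyWalk.lazy_isHermitian G d
  have hdiag (x : V) : M' x x = 1 / 2 := by simp [hM']
  have hconst (x : V) : (M' ^ k) x x = (M' ^ k) r r := by
    obtain ⟨φ, rfl⟩ := hvt r x
    exact LazyWalk.pow_apply_self_eq φ.toEquiv
      (fun a b => by simp [hM', Matrix.one_apply, SimpleGraph.adjMatrix_apply, φ.map_adj_iff]) k r
  obtain ⟨hpos, hlower, hupper⟩ := LazyWalk.trace_sub_constProj_pow_bounds hM hs hdiag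
    (by omega) hlam2ev hlam2max k
  have htr : ((M' - LazyWalk.constProj V) ^ k).trace = Fintype.card V * qk := by
    rw [LazyWalk.sub_constProj_pow hM hs hk]
    simp [Matrix.trace, LazyWalk.constProj, hconst, hqk, mul_sub]
  rw [htr] at hlower hupper
  have hlow : lam2 ^ k / (Fintype.card V : ℝ) ≤ qk := by rwa [div_le_iff₀' hn]
  refine ⟨hlow, le_of_mul_le_mul_left hupper hn, lt_of_lt_of_le (by positivity) hlow, ?_⟩
  have h1 := Matrix.le_one_of_mem_rowStochastic (pow_mem hM k) (i := r) (j := r)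
  have h2 : 0 < 1 / (Fintype.card V : ℝ) := by positivity
  linarith
end

section
/- Let G be a finite connected simple graph on at least 2 vertices, with transition matrix M, let D be the diagonal matrix with entries √(deg x), and let N = D * M * D⁻¹ (a symmetric matrix with the same eigenvalues as M). Then −1 is an eigenvalue of N if and only if G is bipartite. -/
open scoped Classical

section

variable {V : Type*} [Fintype V]

theorem transitionMatrix_mulVec_apply (G : SimpleGraph V) (w : V → ℝ) (x : V) :
    (transitionMatrix G).mulVec w x =
      (∑ y ∈ G.neighborFinset x, w y) / (G.degree x : ℝ) := by
  simp only [Matrix.mulVec, dotProduct, transitionMatrix, Finset.sum_div]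
  rw [SimpleGraph.neighborFinset_eq_filter, Finset.sum_filter]
  refine Finset.sum_congr rfl fun y _ => ?_
  split_ifs <;> ring

/-- On a graph without isolated vertices, `w` is an eigenvector of the walk for `-1` exactly when
the sums `w x + w y` over the neighbors `y` of `x` vanish. -/
theorem transitionMatrix_mulVec_eq_neg_iff (G : SimpleGraph V) (hdeg : ∀ x, 0 < G.degree x)
    (w : V → ℝ) :
    (transitionMatrix G).mulVec w = -w ↔
      ∀ x, ∑ y ∈ G.neighborFinset x, (w x + w y) = 0 := by
  rw [funext_iff]
  refine forall_congr' fun x => ?_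
  have hx : (G.degree x : ℝ) ≠ 0 := by exact_mod_cast (hdeg x).ne'
  rw [transitionMatrix_mulVec_apply, Pi.neg_apply, div_eq_iff hx, Finset.sum_add_distrib,
    Finset.sum_const, SimpleGraph.card_neighborFinset_eq_degree, nsmul_eq_mul]
  constructor <;> intro h <;> linarith

/-- At a point where `|w|` is maximal, the values at the neighbors are the opposite ones. -/
theorem eq_neg_of_adj_of_abs_max {G : SimpleGraph V} {w : V → ℝ} {x y : V}
    (hw : ∑ z ∈ G.neighborFinset x, (w x + w z) = 0) (hmax : ∀ z, |w z| ≤ |w x|)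
    (hxy : G.Adj x y) : w y = -w x := by
  have hy : y ∈ G.neighborFinset x := by simpa using hxy
  rcases le_total 0 (w x) with h | h
  · rw [abs_of_nonneg h] at hmax
    have := (Finset.sum_eq_zero_iff_of_nonneg
      fun z _ => by linarith [(abs_le.mp (hmax z)).1]).mp hw y hy
    linarith
  · rw [abs_of_nonpos h] at hmax
    have := (Finset.sum_eq_zero_iff_of_nonpos
      fun z _ => by linarith [(abs_le.mp (hmax z)).2]).mp hw y hy
    linarith

theorem colorable_two_of_sum_neighbors_eq_zero {G : SimpleGraph V} (hc : G.Connected)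
    {w : V → ℝ} (hne : w ≠ 0) (hw : ∀ x, ∑ y ∈ G.neighborFinset x, (w x + w y) = 0) :
    G.Colorable 2 := by
  have := hc.nonempty
  obtain ⟨a, ha⟩ := Finite.exists_max fun x => |w x|
  have habs : ∀ x, |w x| = |w a| := by
    intro x
    obtain ⟨p⟩ := hc.preconnected x a
    induction p with
    | nil => rfl
    | cons h p ih =>
      have hu := ih ha
      rw [eq_neg_of_adj_of_abs_max (hw _) (fun z => hu ▸ ha z) h.symm, abs_neg, hu]
  have hpos : ∀ x, w x ≠ 0 := by
    intro x hx
    refine hne (funext fun z => abs_eq_zero.mp ?_)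
    rw [habs z, ← habs x, hx, abs_zero]
  have hneg : ∀ {x y}, G.Adj x y → w y = -w x := fun {x _} h =>
    eq_neg_of_adj_of_abs_max (hw _) (fun z => habs x ▸ ha z) h
  let C : G.Coloring Bool := SimpleGraph.Coloring.mk (fun x => decide (0 < w x)) (by
    intro x y h heq
    rw [decide_eq_decide, hneg h] at heq
    rcases lt_or_gt_of_ne (hpos x) with hx | hx
    · linarith [heq.mpr (by linarith)]
    · linarith [heq.mp hx])
  simpa using C.colorable

theorem exists_sum_neighbors_eq_zero_of_colorable_two [Nonempty V] {G : SimpleGraph V}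
    (h : G.Colorable 2) :
    ∃ w : V → ℝ, w ≠ 0 ∧ ∀ x, ∑ y ∈ G.neighborFinset x, (w x + w y) = 0 := by
  obtain ⟨C⟩ := h
  refine ⟨fun x => if C x = 0 then 1 else -1, ?_, fun x => Finset.sum_eq_zero fun y hy => ?_⟩
  · intro h0
    have := congrFun h0 (Classical.arbitrary V)
    dsimp at this
    split_ifs at this <;> norm_num at this
  · have hxy : C x ≠ C y := C.valid (by simpa using hy)
    dsimp
    split_ifs <;> norm_num <;> omega

end

/-- With `N = D M D⁻¹` the symmetrized transition matrix, `-1` is an eigenvalue of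
`N` iff `G` is bipartite (i.e. 2-colorable). -/
theorem stmt_15 {V : Type*} [Fintype V] [DecidableEq V] (G : SimpleGraph V)
    (hc : G.Connected) (hcard : 2 ≤ Fintype.card V)
    (M D N : Matrix V V ℝ)
    (hM : M = transitionMatrix G)
    (hD : D = Matrix.diagonal fun x => Real.sqrt (G.degree x))
    (hN : N = D * M * D⁻¹) :
    (∃ v : V → ℝ, v ≠ 0 ∧ N.mulVec v = (-1 : ℝ) • v) ↔ G.Colorable 2 := by
  have : Nontrivial V := Fintype.one_lt_card_iff_nontrivial.mp hcard
  have hdeg : ∀ x, 0 < G.degree x := fun x => hc.preconnected.degree_pos_of_nontrivial x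
  have hdet : IsUnit D.det := by
    rw [hD, Matrix.det_diagonal, isUnit_iff_ne_zero, Finset.prod_ne_zero_iff]
    exact fun x _ => (Real.sqrt_pos.mpr (by exact_mod_cast hdeg x)).ne'
  constructor
  · rintro ⟨v, hv, hNv⟩
    have hDv : D.mulVec (D⁻¹.mulVec v) = v := by
      rw [Matrix.mulVec_mulVec, Matrix.mul_nonsing_inv _ hdet, Matrix.one_mulVec]
    refine colorable_two_of_sum_neighbors_eq_zero hc (w := D⁻¹.mulVec v) ?_
      ((transitionMatrix_mulVec_eq_neg_iff G hdeg _).mp ?_)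
    · intro h0
      rw [h0, Matrix.mulVec_zero] at hDv
      exact hv hDv.symm
    · have h := congrArg D⁻¹.mulVec hNv
      rwa [hN, Matrix.mulVec_mulVec, mul_assoc, Matrix.nonsing_inv_mul_cancel_left _ _ hdet,
        ← Matrix.mulVec_mulVec, hM, neg_one_smul, Matrix.mulVec_neg] at h
  · intro h
    obtain ⟨w, hw, hsum⟩ := exists_sum_neighbors_eq_zero_of_colorable_two h
    have hDw : D⁻¹.mulVec (D.mulVec w) = w := by
      rw [Matrix.mulVec_mulVec, Matrix.nonsing_inv_mul _ hdet, Matrix.one_mulVec]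
    refine ⟨D.mulVec w, fun h0 => hw ?_, ?_⟩
    · rw [← hDw, h0, Matrix.mulVec_zero]
    · rw [hN, ← Matrix.mulVec_mulVec, hDw, ← Matrix.mulVec_mulVec, hM,
        (transitionMatrix_mulVec_eq_neg_iff G hdeg w).mpr hsum, neg_one_smul, Matrix.mulVec_neg]
end

section
/- Let G be a finite connected simple graph on vertex set V with transition matrix M and a vertex r, and suppose V \ {r} is partitioned into two nonempty sets S_1 and S_2 with no edge of G joining S_1 to S_2. Let G_1 and G_2 be the subgraphs of G induced on S_1 ∪ {r} and S_2 ∪ {r} respectively, with transition matrices M_1 and M_2, and suppose G_1 and G_2 are connected. For a rooted graph (H, r) with transition matrix M_H, define its non-return probabilities by z_0(H) = 1 and, for k ≥ 1, z_k(H) = Σ_{x ≠ r} Σ_{y ≠ r} (M_H r x) · (B_H^{k−1}) x y, where B_H is the submatrix of M_H obtained by deleting the row and column of r. Then for every k ≥ 0, deg_G(r) · z_k(G) = deg_{G_1}(r) · z_k(G_1) + deg_{G_2}(r) · z_k(G_2). -/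
open scoped Classical

/-- `nonReturnProb G r k` is the probability that the simple random walk on `G`
started at `r` does not return to `r` during the first `k` steps:
`z 0 = 1` and, for `k ≥ 1`,
`z k = ∑_{x ≠ r} ∑_{y ≠ r} (M r x) * (B^(k-1)) x y`,
where `B` is the submatrix of `M` deleting the row and column of `r`. -/
noncomputable def nonReturnProb {V : Type*} [Fintype V] (G : SimpleGraph V)
    (r : V) : ℕ → ℝ
  | 0 => 1
  | (k + 1) =>
      ∑ x : {x : V // x ≠ r}, ∑ y : {y : V // y ≠ r},
        transitionMatrix G r (x : V) *
          (((transitionMatrix G).submatrix (fun i : {x : V // x ≠ r} => (i : V))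
              (fun i : {x : V // x ≠ r} => (i : V))) ^ k) x y

/-- `survivalProb G r k x` is the probability that the simple random walk on `G` started at `x`
does not visit `r` at any of the times `1, …, k`. -/
noncomputable def survivalProb {V : Type*} [Fintype V] (G : SimpleGraph V) (r : V) : ℕ → V → ℝ
  | 0, _ => 1
  | k + 1, x => ∑ y : {y : V // y ≠ r}, transitionMatrix G x y * survivalProb G r k y

theorem sum_submatrix_pow_eq_survivalProb {V : Type*} [Fintype V] (G : SimpleGraph V) (r : V)
    (k : ℕ) (x : {x : V // x ≠ r}) :
    ∑ y : {y : V // y ≠ r},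
        (((transitionMatrix G).submatrix (fun i : {x : V // x ≠ r} => (i : V))
          (fun i : {x : V // x ≠ r} => (i : V))) ^ k) x y = survivalProb G r k x := by
  induction k generalizing x with
  | zero => simp [survivalProb, Matrix.one_apply]
  | succ k ih =>
    simp only [pow_succ', Matrix.mul_apply, survivalProb]
    rw [Finset.sum_comm]
    refine Finset.sum_congr rfl fun z _ => ?_
    rw [← Finset.mul_sum, ih, Matrix.submatrix_apply]

theorem nonReturnProb_eq_survivalProb {V : Type*} [Fintype V] (G : SimpleGraph V) (r : V)
    (k : ℕ) : nonReturnProb G r k = survivalProb G r k r := by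
  cases k with
  | zero => rfl
  | succ k =>
    simp only [nonReturnProb, survivalProb, ← Finset.mul_sum, sum_submatrix_pow_eq_survivalProb]

theorem degree_eq_sum_indicator {V : Type*} [Fintype V] (G : SimpleGraph V) (x : V)
    [Fintype (G.neighborSet x)] :
    (G.degree x : ℝ) = ∑ y, (G.neighborSet x).indicator (fun _ => (1 : ℝ)) y := by
  simp only [Set.indicator_apply]
  rw [Finset.sum_boole, ← SimpleGraph.card_neighborFinset_eq_degree]
  congr 2
  ext y
  simp

theorem survivalProb_succ {V : Type*} [Fintype V] (G : SimpleGraph V) (r : V) (k : ℕ) (x : V) :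
    survivalProb G r (k + 1) x =
      (∑ y, (G.neighborSet x).indicator (({r}ᶜ : Set V).indicator (survivalProb G r k)) y) /
        ∑ y, (G.neighborSet x).indicator (fun _ => (1 : ℝ)) y := by
  rw [← degree_eq_sum_indicator, Finset.sum_div, survivalProb,
    ← Finset.sum_subtype (Finset.univ.filter (· ≠ r)) (by simp)
      (fun y => transitionMatrix G x y * survivalProb G r k y), Finset.sum_filter]
  refine Finset.sum_congr rfl fun y _ => ?_
  by_cases hy : y = r <;> by_cases h : G.Adj x y <;>
    simp [transitionMatrix, Set.indicator_apply, hy, h, div_eq_inv_mul]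

theorem degree_mul_nonReturnProb_succ {V : Type*} [Fintype V] (G : SimpleGraph V) (r : V)
    [Fintype (G.neighborSet r)] (k : ℕ) :
    (G.degree r : ℝ) * nonReturnProb G r (k + 1) =
      ∑ y, (G.neighborSet r).indicator (survivalProb G r k) y := by
  have hsub : G.neighborSet r ∩ {r}ᶜ = G.neighborSet r :=
    Set.inter_eq_left.2 fun y (hy : G.Adj r y) => hy.ne'
  rw [nonReturnProb_eq_survivalProb, survivalProb_succ, Set.indicator_indicator, hsub,
    ← degree_eq_sum_indicator]
  by_cases hd : G.degree r = 0
  · have hr : G.neighborSet r = ∅ := Set.eq_empty_of_forall_notMem fun y hy =>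
      ((G.degree_pos_iff_exists_adj r).2 ⟨y, hy⟩).ne' hd
    simp [hr]
  · exact mul_div_cancel₀ _ (by exact_mod_cast hd)

theorem sum_indicator_neighborSet_induce {V : Type*} [Fintype V] (G : SimpleGraph V) (s : Set V)
    [Fintype s] (x : s) (f : V → ℝ) :
    ∑ y : s, ((G.induce s).neighborSet x).indicator (fun y => f y) y =
      ∑ y, (G.neighborSet x ∩ s).indicator f y := by
  have h : ∀ y : s, ((G.induce s).neighborSet x).indicator (fun y => f y) y =
      (G.neighborSet x).indicator f y := fun y => by
    simp [Set.indicator_apply]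
  simp only [h]
  rw [← Finset.sum_subtype (Finset.univ.filter (· ∈ s)) (by simp)
    ((G.neighborSet x).indicator f), Finset.sum_filter]
  refine Finset.sum_congr rfl fun y _ => ?_
  by_cases hy : y ∈ s <;> simp [Set.indicator_apply, hy]

/-- If every vertex of `s` other than `r` has all its neighbours in `s`, then the survival
probabilities from those vertices can be computed in the induced subgraph. -/
theorem survivalProb_induce {V : Type*} [Fintype V] (G : SimpleGraph V) (s : Set V) [Fintype s]
    (r : s) (hs : ∀ x ∈ s, x ≠ r → ∀ y, G.Adj x y → y ∈ s) (k : ℕ) (x : s) (hx : x ≠ r) :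
    survivalProb (G.induce s) r k x = survivalProb G r k x := by
  induction k generalizing x with
  | zero => rfl
  | succ k ih =>
    have hxs : G.neighborSet x ∩ s = G.neighborSet x :=
      Set.inter_eq_left.2 (hs x x.2 fun e => hx (Subtype.ext e))
    have hk : ({r}ᶜ : Set s).indicator (survivalProb (G.induce s) r k) =
        fun y : s => ({(r : V)}ᶜ : Set V).indicator (survivalProb G r k) y := by
      funext y
      by_cases hy : y = r
      · simp [hy]
      · have hy' : (y : V) ≠ r := fun e => hy (Subtype.ext e)
        simp [hy, hy', ih y hy]
    rw [survivalProb_succ, survivalProb_succ, hk, sum_indicator_neighborSet_induce,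
      sum_indicator_neighborSet_induce G s x fun _ => 1, hxs]

theorem degree_mul_nonReturnProb_induce_succ {V : Type*} [Fintype V] (G : SimpleGraph V)
    (s : Set V) [Fintype s] (r : s) [Fintype ((G.induce s).neighborSet r)]
    (hs : ∀ x ∈ s, x ≠ r → ∀ y, G.Adj x y → y ∈ s) (k : ℕ) :
    ((G.induce s).degree r : ℝ) * nonReturnProb (G.induce s) r (k + 1) =
      ∑ y, (G.neighborSet r ∩ s).indicator (survivalProb G r k) y := by
  rw [degree_mul_nonReturnProb_succ, ← sum_indicator_neighborSet_induce]
  refine Finset.sum_congr rfl fun y _ => ?_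
  by_cases h : y ∈ (G.induce s).neighborSet r
  · rw [Set.indicator_of_mem h, Set.indicator_of_mem h,
      survivalProb_induce G s r hs k y ((G.induce s).ne_of_adj h).symm]
  · rw [Set.indicator_of_notMem h, Set.indicator_of_notMem h]

theorem degree_induce_eq_sum_indicator {V : Type*} [Fintype V] (G : SimpleGraph V) (s : Set V)
    [Fintype s] (x : s) [Fintype ((G.induce s).neighborSet x)] :
    ((G.induce s).degree x : ℝ) =
      ∑ y, (G.neighborSet x ∩ s).indicator (fun _ => (1 : ℝ)) y := by
  rw [degree_eq_sum_indicator, ← sum_indicator_neighborSet_induce]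

theorem sum_indicator_neighborSet_eq_add {V : Type*} [Fintype V] (G : SimpleGraph V) (r : V)
    (S1 S2 : Set V) (hdisj : Disjoint S1 S2) (hcover : S1 ∪ S2 = {r}ᶜ) (f : V → ℝ) :
    ∑ y, (G.neighborSet r).indicator f y =
      ∑ y, (G.neighborSet r ∩ (S1 ∪ {r})).indicator f y +
        ∑ y, (G.neighborSet r ∩ (S2 ∪ {r})).indicator f y := by
  rw [← Finset.sum_add_distrib]
  refine Finset.sum_congr rfl fun y _ => ?_
  by_cases h : G.Adj r y
  · have hy : y ∈ S1 ∪ S2 := hcover ▸ h.ne'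
    rcases hy with hy | hy
    · simp [h, h.ne', hy, Set.disjoint_left.1 hdisj hy]
    · simp [h, h.ne', hy, Set.disjoint_right.1 hdisj hy]
  · simp [h]

theorem mem_union_root_of_adj {V : Type*} (G : SimpleGraph V) (r : V) (S1 S2 : Set V)
    (hcover : S1 ∪ S2 = {r}ᶜ) (hnoedge : ∀ x ∈ S1, ∀ y ∈ S2, ¬ G.Adj x y) :
    ∀ x ∈ S1 ∪ {r}, x ≠ r → ∀ y, G.Adj x y → y ∈ S1 ∪ {r} := by
  intro x hx hxr y hxy
  have hx1 : x ∈ S1 := hx.resolve_right hxr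
  by_cases hy : y = r
  · exact Or.inr hy
  · have hy' : y ∈ S1 ∪ S2 := hcover ▸ hy
    exact Or.inl (hy'.resolve_right fun h2 => hnoedge x hx1 y h2 hxy)

/-- Gluing two rooted graphs at the root: if `V \ {r}` splits into nonempty parts
`S1`, `S2` with no edges between them, then the (degree-weighted) non-return
probabilities of `G` are the sums of those of the induced rooted subgraphs. -/
theorem stmt_16 {V : Type*} [Fintype V] [DecidableEq V] (G : SimpleGraph V)
    (hc : G.Connected) (r : V) (S1 S2 : Set V)
    (hS1 : S1.Nonempty) (hS2 : S2.Nonempty)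
    (hdisj : Disjoint S1 S2) (hcover : S1 ∪ S2 = {r}ᶜ)
    (hnoedge : ∀ x ∈ S1, ∀ y ∈ S2, ¬ G.Adj x y)
    (hc1 : (G.induce (S1 ∪ {r})).Connected)
    (hc2 : (G.induce (S2 ∪ {r})).Connected) :
    ∀ k : ℕ,
      (G.degree r : ℝ) * nonReturnProb G r k =
        ((G.induce (S1 ∪ {r})).degree ⟨r, by simp⟩ : ℝ) *
            nonReturnProb (G.induce (S1 ∪ {r})) ⟨r, by simp⟩ k +
          ((G.induce (S2 ∪ {r})).degree ⟨r, by simp⟩ : ℝ) *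
            nonReturnProb (G.induce (S2 ∪ {r})) ⟨r, by simp⟩ k := by
  intro k
  cases k with
  | zero =>
    simp only [nonReturnProb, mul_one]
    rw [degree_eq_sum_indicator, degree_induce_eq_sum_indicator, degree_induce_eq_sum_indicator]
    exact sum_indicator_neighborSet_eq_add G r S1 S2 hdisj hcover _
  | succ k =>
    rw [degree_mul_nonReturnProb_succ,
      degree_mul_nonReturnProb_induce_succ G (S1 ∪ {r}) ⟨r, by simp⟩
        (mem_union_root_of_adj G r S1 S2 hcover hnoedge),
      degree_mul_nonReturnProb_induce_succ G (S2 ∪ {r}) ⟨r, by simp⟩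
        (mem_union_root_of_adj G r S2 S1 (Set.union_comm S1 S2 ▸ hcover)
          fun x hx y hy h => hnoedge y hy x hx h.symm)]
    exact sum_indicator_neighborSet_eq_add G r S1 S2 hdisj hcover _
end

section
/- Let T_A be the following tree on 11 vertices: a vertex v is adjacent to the root r', to one leaf, and to two vertices c_1, c_2, each of which is adjacent to three further leaves. Let T_B be the following tree on 11 vertices: a vertex w is adjacent to the root r'', and to the initial vertices of three disjoint paths of length 2 attached at w (i.e., w is joined to three vertices, each of which is joined to one further leaf). Let M_A and M_B be the transition matrices of the simple random walks on T_A and T_B. Then for every natural number k, (M_A^k) r' r' = (M_B^k) r'' r''; that is, the return time distributions to the roots coincide. Moreover, T_A and T_B do not have the same characteristic polynomial of their transition matrices (the eigenvalue multiplicities differ). -/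
open scoped Classical

/-- Edges of the tree `T_A`: the root `0` is joined to `1`; vertex `1` is joined to
the leaf `2` and to `3` and `4`, each of which is joined to three further leaves. -/
def edgesA : List (Fin 11 × Fin 11) :=
  [(0, 1), (1, 2), (1, 3), (1, 4), (3, 5), (3, 6), (3, 7), (4, 8), (4, 9), (4, 10)]

/-- Edges of the tree `T_B`: the root `0` is joined to `1`; vertex `1` is joined to
the initial vertices `2`, `5`, `8` of three disjoint paths `2-3-4`, `5-6-7`,
`8-9-10`. -/
def edgesB : List (Fin 11 × Fin 11) :=
  [(0, 1), (1, 2), (2, 3), (3, 4), (1, 5), (5, 6), (6, 7), (1, 8), (8, 9), (9, 10)]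

/-- The tree `T_A` on 11 vertices. -/
def TA : SimpleGraph (Fin 11) := SimpleGraph.fromRel fun a b => (a, b) ∈ edgesA

/-- The tree `T_B` on 11 vertices. -/
def TB : SimpleGraph (Fin 11) := SimpleGraph.fromRel fun a b => (a, b) ∈ edgesB

open Polynomial in
/-- The characteristic polynomial of a real matrix determines that of its square. -/
lemma Matrix.charpoly_sq_eq_of_charpoly_eq {n : Type*} [Fintype n] [DecidableEq n]
    {M N : Matrix n n ℝ} (h : M.charpoly = N.charpoly) :
    (M ^ 2).charpoly = (N ^ 2).charpoly := by
  have key (L : Matrix n n ℝ) (t : ℝ) : (L ^ 2).charpoly.eval (t ^ 2) =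
      (-1) ^ Fintype.card n * (L.charpoly.eval t * L.charpoly.eval (-t)) := by
    simp only [Matrix.eval_charpoly]
    rw [mul_left_comm, ← Matrix.det_neg, ← Matrix.det_mul]
    congr 1
    have hc : Commute (Matrix.scalar n t) L := Matrix.scalar_commute t (fun _ => mul_comm _ _) L
    rw [map_neg, map_pow, neg_sub, sub_neg_eq_add, add_comm L]
    simpa [← sub_eq_add_neg] using hc.neg_right.sq_sub_sq
  refine eq_of_infinite_eval_eq _ _ ((Set.Ici_infinite (0 : ℝ)).mono fun x hx => ?_)
  rw [Set.mem_ofPred_eq, ← Real.sq_sqrt (Set.mem_Ici.mp hx), key, key, h]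

/-- If `F` intertwines `M` and `C` and maps the basis vector at `s` to the one at `r`,
while its row at `r` is the basis vector at `s`, then the return sequences of `M` at `r`
and of `C` at `s` agree. -/
lemma Matrix.pow_apply_eq_of_intertwine {m n R : Type*} [Fintype m] [Fintype n]
    [DecidableEq m] [DecidableEq n] [Semiring R] {M : Matrix m m R} {C : Matrix n n R}
    {F : Matrix m n R} {r : m} {s : n} (h : M * F = F * C)
    (hcol : ∀ i, F i s = if i = r then 1 else 0) (hrow : ∀ j, F r j = if j = s then 1 else 0)
    (k : ℕ) : (M ^ k) r r = (C ^ k) s s := by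
  have hk : M ^ k * F = F * C ^ k := by
    induction k with
    | zero => simp
    | succ k ih => rw [pow_succ, Matrix.mul_assoc, h, ← Matrix.mul_assoc, ih, Matrix.mul_assoc,
        ← pow_succ]
  simpa [Matrix.mul_apply, hcol, hrow] using congrFun (congrFun hk r) s

/-- The transition matrix, with rational entries, of the graph with the listed edges. -/
def ratTransitionMatrix {n : ℕ} (l : List (Fin n × Fin n)) : Matrix (Fin n) (Fin n) ℚ :=
  fun x y => if x ≠ y ∧ ((x, y) ∈ l ∨ (y, x) ∈ l) then
    ((Finset.univ.filter fun z => x ≠ z ∧ ((x, z) ∈ l ∨ (z, x) ∈ l)).card : ℚ)⁻¹ else 0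

lemma transitionMatrix_fromRel {n : ℕ} (l : List (Fin n × Fin n)) :
    transitionMatrix (SimpleGraph.fromRel fun a b => (a, b) ∈ l) =
      (ratTransitionMatrix l).map (Rat.castHom ℝ) := by
  ext x y
  have hdeg [Fintype ((SimpleGraph.fromRel fun a b => (a, b) ∈ l).neighborSet x)] :
      (SimpleGraph.fromRel fun a b => (a, b) ∈ l).degree x =
      (Finset.univ.filter fun z => x ≠ z ∧ ((x, z) ∈ l ∨ (z, x) ∈ l)).card := by
    rw [← SimpleGraph.card_neighborFinset_eq_degree]
    congr 1
    ext z
    simp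
  simp only [transitionMatrix, ratTransitionMatrix, Matrix.map_apply, hdeg,
    SimpleGraph.fromRel_adj, one_div]
  split_ifs <;> simp

/-- The walk on `T_A` lumped along the orbits of the automorphisms fixing the root. -/
def lumpedA : Matrix (Fin 5) (Fin 5) ℚ :=
  !![0, 1, 0, 0, 0; 1/4, 0, 1/4, 1/2, 0; 0, 1, 0, 0, 0; 0, 1/4, 0, 0, 3/4; 0, 0, 0, 1, 0]

/-- The indicator functions of the orbits in `T_A`. -/
def orbitsA : Matrix (Fin 11) (Fin 5) ℚ :=
  !![1, 0, 0, 0, 0; 0, 1, 0, 0, 0; 0, 0, 1, 0, 0; 0, 0, 0, 1, 0; 0, 0, 0, 1, 0;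
    0, 0, 0, 0, 1; 0, 0, 0, 0, 1; 0, 0, 0, 0, 1; 0, 0, 0, 0, 1; 0, 0, 0, 0, 1; 0, 0, 0, 0, 1]

/-- Functions on `T_B` which transform under its walk as the orbit indicators on `T_A` do. -/
def intertwinerB : Matrix (Fin 11) (Fin 5) ℚ :=
  !![1, 0, 0, 0, 0; 0, 1, 0, 0, 0;
    0, 0, 1/3, 2/3, 0; 0, 0, 0, 0, 1; 0, 0, -1/3, 4/3, 0;
    0, 0, 1/3, 2/3, 0; 0, 0, 0, 0, 1; 0, 0, -1/3, 4/3, 0;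
    0, 0, 1/3, 2/3, 0; 0, 0, 0, 0, 1; 0, 0, -1/3, 4/3, 0]

lemma ratTransitionMatrix_edgesA_pow (k : ℕ) :
    (ratTransitionMatrix edgesA ^ k) 0 0 = (lumpedA ^ k) 0 0 :=
  Matrix.pow_apply_eq_of_intertwine (F := orbitsA)
    (by decide +kernel) (by decide +kernel) (by decide +kernel) k

lemma ratTransitionMatrix_edgesB_pow (k : ℕ) :
    (ratTransitionMatrix edgesB ^ k) 0 0 = (lumpedA ^ k) 0 0 :=
  Matrix.pow_apply_eq_of_intertwine (F := intertwinerB)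
    (by decide +kernel) (by decide +kernel) (by decide +kernel) k

lemma trace_ratTransitionMatrix_sq_ne :
    (ratTransitionMatrix edgesA ^ 2).trace ≠ (ratTransitionMatrix edgesB ^ 2).trace := by
  rw [sq, sq]
  decide +kernel

/-- The trees `T_A` and `T_B` have the same return probabilities at their roots
(hence the same return time distributions), but their transition matrices have
different characteristic polynomials. -/
theorem stmt_18 :
    (∀ k : ℕ, ((transitionMatrix TA) ^ k) 0 0 = ((transitionMatrix TB) ^ k) 0 0) ∧
      (transitionMatrix TA).charpoly ≠ (transitionMatrix TB).charpoly := by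
  rw [TA, TB, transitionMatrix_fromRel, transitionMatrix_fromRel]
  refine ⟨fun k => ?_, fun h => trace_ratTransitionMatrix_sq_ne ?_⟩
  · rw [← Matrix.map_pow, ← Matrix.map_pow, Matrix.map_apply, Matrix.map_apply,
      ratTransitionMatrix_edgesA_pow, ratTransitionMatrix_edgesB_pow]
  · have htr := congrArg (fun p => -p.nextCoeff) (Matrix.charpoly_sq_eq_of_charpoly_eq h)
    simp only [← Matrix.trace_eq_neg_charpoly_nextCoeff, ← Matrix.map_pow] at htr
    rw [← AddMonoidHom.map_trace, ← AddMonoidHom.map_trace] at htr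
    exact (Rat.castHom ℝ).injective htr
end
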